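/- Let f(u,v) = (uv/2 + v, u − v²/2) and η(u,v) = u²/2 + (1 + u/2) v²/2 − v⁴/16. Then the vector field G(u,v) := (∇η(u,v))ᵀ Df(u,v) on ℝ², which equals G(u,v) = (uv + v − v³/8, u²/2 + u − (3/8)uv² − (3/4)v² + v⁴/4), is a gradient field: there exists a smooth function q : ℝ² → ℝ with ∇q = G. Hence (η, q) is an entropy–entropy flux pair for the system, i.e., every C¹ solution of ∂ₜU + ∂ₓ f(U) = 0 also satisfies ∂ₜ η(U) + ∂ₓ q(U) = 0. -/

import Mathlib

noncomputable section

/-- The flux of the example system: `f(u,v) = (uv/2 + v, u - v²/2)`. -/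
def exFlux (w : Fin 2 → ℝ) : Fin 2 → ℝ :=
  ![w 0 * w 1 / 2 + w 1, w 0 - w 1 ^ 2 / 2]

/-- The entropy `η(u,v) = u²/2 + (1 + u/2) v²/2 - v⁴/16` of the example system. -/
def exEntropy (w : Fin 2 → ℝ) : ℝ :=
  w 0 ^ 2 / 2 + (1 + w 0 / 2) * w 1 ^ 2 / 2 - w 1 ^ 4 / 16

/-- The vector field `G = (∇η)ᵀ Df`, computed explicitly. -/
def exG (w : Fin 2 → ℝ) : Fin 2 → ℝ :=
  ![w 0 * w 1 + w 1 - w 1 ^ 3 / 8,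
    w 0 ^ 2 / 2 + w 0 - (3 / 8) * w 0 * w 1 ^ 2 - (3 / 4) * w 1 ^ 2 + w 1 ^ 4 / 4]

/-- The linear form `(a, b)` on the plane. -/
def exForm (a b : ℝ) : (Fin 2 → ℝ) →L[ℝ] ℝ :=
  a • ContinuousLinearMap.proj (R := ℝ) (φ := fun _ : Fin 2 => ℝ) 0
    + b • ContinuousLinearMap.proj (R := ℝ) (φ := fun _ : Fin 2 => ℝ) 1

theorem exForm_apply (a b : ℝ) (h : Fin 2 → ℝ) : exForm a b h = a * h 0 + b * h 1 := by
  simp [exForm]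

/-- The entropy flux. -/
def exQ (w : Fin 2 → ℝ) : ℝ :=
  w 0 ^ 2 * w 1 / 2 + w 0 * w 1 - w 0 * w 1 ^ 3 / 8 - w 1 ^ 3 / 4 + w 1 ^ 5 / 20

/-- The derivative of the flux. -/
def exDF (p : Fin 2 → ℝ) : (Fin 2 → ℝ) →L[ℝ] (Fin 2 → ℝ) :=
  ContinuousLinearMap.pi ![exForm (p 1 / 2) (p 0 / 2 + 1), exForm 1 (-p 1)]

theorem hasFDerivAt_coord (p : Fin 2 → ℝ) (i : Fin 2) :
    HasFDerivAt (fun w : Fin 2 → ℝ => w i)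
      (ContinuousLinearMap.proj (R := ℝ) (φ := fun _ : Fin 2 => ℝ) i) p :=
  hasFDerivAt_apply i p

theorem exEntropy_hasFDerivAt (p : Fin 2 → ℝ) :
    HasFDerivAt exEntropy
      (exForm (p 0 + p 1 ^ 2 / 4) ((1 + p 0 / 2) * p 1 - p 1 ^ 3 / 4)) p := by
  have h0 := hasFDerivAt_coord p 0
  have h1 := hasFDerivAt_coord p 1
  have h := (((h0.pow 2).mul_const (1 / 2)).add
    ((((h0.mul_const (1 / 2)).const_add 1).mul (h1.pow 2)).mul_const (1 / 2))).sub
    ((h1.pow 4).mul_const (1 / 16))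
  refine (h.congr_fderiv ?_).congr_of_eventuallyEq (Filter.Eventually.of_forall fun w => ?_)
  · ext v
    simp [exForm]
    ring
  · simp [exEntropy]
    ring

theorem exQ_hasFDerivAt (p : Fin 2 → ℝ) :
    HasFDerivAt exQ (exForm (exG p 0) (exG p 1)) p := by
  have h0 := hasFDerivAt_coord p 0
  have h1 := hasFDerivAt_coord p 1
  have h := (((((h0.pow 2).mul h1).mul_const (1 / 2)).add (h0.mul h1)).sub
    ((h0.mul (h1.pow 3)).mul_const (1 / 8))).sub ((h1.pow 3).mul_const (1 / 4)) |>.add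
    ((h1.pow 5).mul_const (1 / 20))
  refine (h.congr_fderiv ?_).congr_of_eventuallyEq (Filter.Eventually.of_forall fun w => ?_)
  · ext v
    simp [exForm, exG]
    ring
  · simp [exQ]
    ring

theorem exFlux_hasFDerivAt (p : Fin 2 → ℝ) : HasFDerivAt exFlux (exDF p) p := by
  have h0 := hasFDerivAt_coord p 0
  have h1 := hasFDerivAt_coord p 1
  rw [hasFDerivAt_pi']
  intro i
  fin_cases i
  · have h := ((h0.mul h1).mul_const (1 / 2)).add h1
    refine (h.congr_fderiv ?_).congr_of_eventuallyEq (Filter.Eventually.of_forall fun w => ?_)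
    · ext v
      simp [exForm, exDF]
      ring
    · simp [exFlux]
      ring
  · have h := h0.sub ((h1.pow 2).mul_const (1 / 2))
    refine (h.congr_fderiv ?_).congr_of_eventuallyEq (Filter.Eventually.of_forall fun w => ?_)
    · ext v
      simp [exForm, exDF]
      try ring
    · simp [exFlux]
      try ring

/-- The compatibility relation `∇q = (∇η)ᵀ Df`. -/
theorem exCompat (p h : Fin 2 → ℝ) :
    exForm (exG p 0) (exG p 1) h =
      exForm (p 0 + p 1 ^ 2 / 4) ((1 + p 0 / 2) * p 1 - p 1 ^ 3 / 4) (exDF p h) := by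
  simp [exForm_apply, exDF, exG]
  ring

/-- `G = (∇η)ᵀ Df` equals the displayed explicit vector field, and it is a
gradient field: there is a smooth `q` with `∇q = G`.  Hence `(η, q)` is an
entropy–entropy flux pair: every `C¹` solution of `∂ₜU + ∂ₓ f(U) = 0` satisfies
`∂ₜ η(U) + ∂ₓ q(U) = 0`. -/
theorem example_entropy_flux_pair :
    (∀ p : Fin 2 → ℝ, ∀ j : Fin 2,
        exG p j = fderiv ℝ exEntropy p (fderiv ℝ exFlux p (Pi.single j 1))) ∧
    ∃ q : (Fin 2 → ℝ) → ℝ, ContDiff ℝ (⊤ : ℕ∞) q ∧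
      (∀ (p : Fin 2 → ℝ) (j : Fin 2), fderiv ℝ q p (Pi.single j 1) = exG p j) ∧
      ∀ U : ℝ × ℝ → Fin 2 → ℝ, ContDiff ℝ 1 U →
        (∀ z : ℝ × ℝ,
          fderiv ℝ U z (1, 0) + fderiv ℝ (fun y => exFlux (U y)) z (0, 1) = 0) →
        ∀ z : ℝ × ℝ,
          fderiv ℝ (fun y => exEntropy (U y)) z (1, 0)
            + fderiv ℝ (fun y => q (U y)) z (0, 1) = 0 := by
  refine ⟨fun p j => ?_, exQ, ?_, fun p j => ?_, fun U hU hsol z => ?_⟩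
  · rw [(exEntropy_hasFDerivAt p).fderiv, (exFlux_hasFDerivAt p).fderiv, ← exCompat, exForm_apply]
    fin_cases j <;> simp
  · unfold exQ
    fun_prop
  · rw [(exQ_hasFDerivAt p).fderiv, exForm_apply]
    fin_cases j <;> simp
  · have hd : HasFDerivAt U (fderiv ℝ U z) z :=
      ((hU.differentiable (by norm_num)) z).hasFDerivAt
    have hs := hsol z
    have e1 : HasFDerivAt (fun y => exFlux (U y)) _ z := (exFlux_hasFDerivAt (U z)).comp z hd
    have e2 : HasFDerivAt (fun y => exEntropy (U y)) _ z :=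
      (exEntropy_hasFDerivAt (U z)).comp z hd
    have e3 : HasFDerivAt (fun y => exQ (U y)) _ z := (exQ_hasFDerivAt (U z)).comp z hd
    rw [e1.fderiv] at hs
    rw [e2.fderiv, e3.fderiv]
    simp only [ContinuousLinearMap.comp_apply] at hs ⊢
    rw [exCompat, ← map_add, hs, map_zero]
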